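/- For every play π of a serial two-player game graph G with a layering of depth L, every layer l ∈ [0,L-1], and every k in the domain of the timescale transformation κ^{l+1}, there exists m in the domain of κ^l with κ^{l+1}(k) = κ^l(m); moreover the last entry of κ^l is greater than or equal to the last entry of κ^{l+1}. -/

import Mathlib

noncomputable section

/-! ## Two-player game graphs and plays -/

/-- A two-player game graph between an environment and a system player. -/
structure GameGraph (X Y : Type) where
  de : X → Y → Set X
  ds : X → Y → Set Y

/-- A game graph is serial if both transition maps take only nonempty values. -/
def GameGraph.Serial {X Y : Type} (G : GameGraph X Y) : Prop :=
  ∀ x y, (G.de x y).Nonempty ∧ (G.ds x y).Nonempty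

/-- A finite or infinite sequence over `X × Y`, represented by total functions together
with an explicit length in `ℕ∞` (entries beyond the length are irrelevant). -/
structure Play (X Y : Type) where
  len : ℕ∞
  x : ℕ → X
  y : ℕ → Y

namespace Play

variable {X Y : Type}

/-- A play is finite if its length is not `⊤`. -/
def Finite (π : Play X Y) : Prop := π.len ≠ ⊤

/-- Entrywise prefix relation on plays. -/
protected def Prefix (π π' : Play X Y) : Prop :=
  π.len ≤ π'.len ∧ ∀ k : ℕ, (k : ℕ∞) < π.len → π.x k = π'.x k ∧ π.y k = π'.y k

/-- The string `π|_[0,n]` (a list of `n+1` state pairs). -/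
def prefList (π : Play X Y) (n : ℕ) : List (X × Y) :=
  (List.range (n + 1)).map fun k => (π.x k, π.y k)

/-- The prefix play `π|_[0,n]`. -/
def prefixPlay (π : Play X Y) (n : ℕ) : Play X Y := ⟨((n + 1 : ℕ) : ℕ∞), π.x, π.y⟩

/-- The suffix play of `π` starting at position `n`. -/
def suffixPlay (π : Play X Y) (n : ℕ) : Play X Y :=
  ⟨π.len - (n : ℕ∞), fun k => π.x (n + k), fun k => π.y (n + k)⟩

end Play

/-- `π` is a play of the game graph `G`. -/
def IsPlay {X Y : Type} (G : GameGraph X Y) (π : Play X Y) : Prop :=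
  1 ≤ π.len ∧ ∀ k : ℕ, ((k + 1 : ℕ) : ℕ∞) < π.len →
    π.x (k + 1) ∈ G.de (π.x k) (π.y k) ∧ π.y (k + 1) ∈ G.ds (π.x (k + 1)) (π.y k)

/-- The prefix closure of a set of plays: the set together with all its finite prefixes. -/
def prefClosure {X Y : Type} (φ : Set (Play X Y)) : Set (Play X Y) :=
  φ ∪ {π | π.Finite ∧ ∃ π' ∈ φ, π.Prefix π'}

/-- A string lies in the prefix closure of a set of plays. -/
def strInClosure {X Y : Type} (φ : Set (Play X Y)) (w : List (X × Y)) : Prop :=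
  ∃ π ∈ φ, (w.length : ℕ∞) ≤ π.len ∧
    ∀ (k : ℕ) (hk : k < w.length), w[k] = (π.x k, π.y k)

/-- Conversion of a string into a (finite) play, w.r.t. given default values. -/
def listToPlay {X Y : Type} (dx : X) (dy : Y) (w : List (X × Y)) : Play X Y :=
  ⟨(w.length : ℕ∞), fun k => (w.getD k (dx, dy)).1, fun k => (w.getD k (dx, dy)).2⟩

/-! ## Strategies, compliant plays, winning and admissibility -/

/-- System strategies: partial functions from nonempty strings and environment states
to system states, represented via `Option`. -/
def SysStrategy (X Y : Type) := List (X × Y) → X → Option Y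

/-- A system strategy respects the system transition map. -/
def IsSysStrategy {X Y : Type} (G : GameGraph X Y) (f : SysStrategy X Y) : Prop :=
  ∀ (w : List (X × Y)) (x : X) (yv : Y) (p : X × Y),
    w.getLast? = some p → f w x = some yv → yv ∈ G.ds x p.2

/-- Environment strategies: total functions from strings to environment states. -/
def EnvStrategy (X Y : Type) := List (X × Y) → X

/-- An environment strategy respects the environment transition map. -/
def IsEnvStrategy {X Y : Type} (G : GameGraph X Y) (g : EnvStrategy X Y) : Prop :=
  ∀ (w : List (X × Y)) (p : X × Y), w.getLast? = some p → g w ∈ G.de p.1 p.2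

/-- A play is compliant with a system strategy `f`, an environment strategy `g` and a
set of initial strings `I`. -/
def Compliant {X Y : Type} (f : SysStrategy X Y) (g : EnvStrategy X Y)
    (I : Set (List (X × Y))) (π : Play X Y) : Prop :=
  ∃ n : ℕ, (n : ℕ∞) < π.len ∧ π.prefList n ∈ I ∧
    ∀ k : ℕ, (k : ℕ∞) < π.len → n < k →
      π.x k = g (π.prefList (k - 1)) ∧ f (π.prefList (k - 1)) (π.x k) = some (π.y k)

/-- A play is compliant with `f` and `I` (for some environment strategy). -/
def CompliantF {X Y : Type} (G : GameGraph X Y) (f : SysStrategy X Y)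
    (I : Set (List (X × Y))) (π : Play X Y) : Prop :=
  ∃ g : EnvStrategy X Y, IsEnvStrategy G g ∧ Compliant f g I π

/-- A play is compliant with an environment strategy `g` and initial strings `I`. -/
def CompliantWithEnv {X Y : Type} (g : EnvStrategy X Y)
    (I : Set (List (X × Y))) (π : Play X Y) : Prop :=
  ∃ n : ℕ, (n : ℕ∞) < π.len ∧ π.prefList n ∈ I ∧
    ∀ k : ℕ, (k : ℕ∞) < π.len → n < k → π.x k = g (π.prefList (k - 1))

/-- A play is winning for the game `(G, I, φ)`: some prefix lies in `I` and the play is in `φ`. -/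
def WinningPlay {X Y : Type} (I : Set (List (X × Y))) (φ : Set (Play X Y))
    (π : Play X Y) : Prop :=
  (∃ n : ℕ, (n : ℕ∞) < π.len ∧ π.prefList n ∈ I) ∧ π ∈ φ

/-- A play is possibly winning: some prefix lies in `I` and it lies in the prefix closure of `φ`. -/
def PossiblyWinningPlay {X Y : Type} (I : Set (List (X × Y))) (φ : Set (Play X Y))
    (π : Play X Y) : Prop :=
  (∃ n : ℕ, (n : ℕ∞) < π.len ∧ π.prefList n ∈ I) ∧ π ∈ prefClosure φ

/-- `f` is a winning system strategy for `(G, I, φ)` against the environment strategy `g`. -/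
def WinningAgainst {X Y : Type} (G : GameGraph X Y) (I : Set (List (X × Y)))
    (φ : Set (Play X Y)) (f : SysStrategy X Y) (g : EnvStrategy X Y) : Prop :=
  ∀ π : Play X Y, IsPlay G π → Compliant f g I π →
    ∃ π' : Play X Y, IsPlay G π' ∧ π.Prefix π' ∧ Compliant f g I π' ∧ WinningPlay I φ π'

/-- `f` is dominated by `f'` in the game `(G, I, φ)`. -/
def SysDominatedBy {X Y : Type} (G : GameGraph X Y) (I : Set (List (X × Y)))
    (φ : Set (Play X Y)) (f f' : SysStrategy X Y) : Prop :=
  ∀ g : EnvStrategy X Y, IsEnvStrategy G g →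
    WinningAgainst G I φ f g → WinningAgainst G I φ f' g

/-- Admissible system strategies. -/
def SysAdmissible {X Y : Type} (G : GameGraph X Y) (I : Set (List (X × Y)))
    (φ : Set (Play X Y)) (f : SysStrategy X Y) : Prop :=
  IsSysStrategy G f ∧ ¬ ∃ f' : SysStrategy X Y, IsSysStrategy G f' ∧ SysDominatedBy G I φ f f'

/-- Dually, `g` is a winning environment strategy for `(G, I, ζ)` against `f`. -/
def EnvWinningAgainst {X Y : Type} (G : GameGraph X Y) (I : Set (List (X × Y)))
    (ζ : Set (Play X Y)) (g : EnvStrategy X Y) (f : SysStrategy X Y) : Prop :=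
  ∀ π : Play X Y, IsPlay G π → Compliant f g I π →
    ∃ π' : Play X Y, IsPlay G π' ∧ π.Prefix π' ∧ Compliant f g I π' ∧ WinningPlay I ζ π'

/-- `g` is dominated by `g'` in the game `(G, I, ζ)` (dual notion). -/
def EnvDominatedBy {X Y : Type} (G : GameGraph X Y) (I : Set (List (X × Y)))
    (ζ : Set (Play X Y)) (g g' : EnvStrategy X Y) : Prop :=
  ∀ f : SysStrategy X Y, IsSysStrategy G f →
    EnvWinningAgainst G I ζ g f → EnvWinningAgainst G I ζ g' f

/-- Admissible environment strategies (dual notion). -/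
def EnvAdmissible {X Y : Type} (G : GameGraph X Y) (I : Set (List (X × Y)))
    (ζ : Set (Play X Y)) (g : EnvStrategy X Y) : Prop :=
  IsEnvStrategy G g ∧ ¬ ∃ g' : EnvStrategy X Y, IsEnvStrategy G g' ∧ EnvDominatedBy G I ζ g g'

/-- `fAA` is assume-admissibly winning for `(G, I, φ)` w.r.t. the assumption `ζ`. -/
def AssumeAdmissiblyWinning {X Y : Type} (G : GameGraph X Y) (I : Set (List (X × Y)))
    (φ ζ : Set (Play X Y)) (fAA : SysStrategy X Y) : Prop :=
  SysAdmissible G I φ fAA ∧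
    ∀ g : EnvStrategy X Y, EnvAdmissible G I ζ g → WinningAgainst G I φ fAA g

/-- `f` is the possibly winning strategy associated to `fAA`: it follows `fAA` as long as the
produced string stays inside the prefix closure of `φ`, and blocks otherwise. -/
def IsAssociatedSol {X Y : Type} (φ : Set (Play X Y)) (fAA f : SysStrategy X Y) : Prop :=
  (∀ w x, fAA w x = none → f w x = none) ∧
  ∀ w x yv, fAA w x = some yv →
    (strInClosure φ (w ++ [(x, yv)]) → f w x = some yv) ∧
    (¬ strInClosure φ (w ++ [(x, yv)]) → f w x = none)

/-- `f ∈ Sol(G, I, φ, ζ)`: `f` is a possibly winning strategy obtained from some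
assume-admissibly winning strategy. -/
def IsSol {X Y : Type} (G : GameGraph X Y) (I : Set (List (X × Y)))
    (φ ζ : Set (Play X Y)) (f : SysStrategy X Y) : Prop :=
  ∃ fAA : SysStrategy X Y, IsSysStrategy G fAA ∧
    AssumeAdmissiblyWinning G I φ ζ fAA ∧ IsAssociatedSol φ fAA f

/-! ## Layerings, abstract plays and timescale transformations -/

/-- A layering: state families for every layer together with abstraction functions
(and default states, used to interpret strings as plays). -/
structure Layering where
  XL : ℕ → Type
  YL : ℕ → Type
  ry : ∀ l : ℕ, YL l → YL (l + 1)
  rx : ∀ l : ℕ, XL l × YL l → XL (l + 1)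
  defX : ∀ l : ℕ, XL l
  defY : ∀ l : ℕ, YL l

/-- Composed system abstraction `ry^{↑l}`. -/
def Layering.ryUp (ℒ : Layering) : (l : ℕ) → ℒ.YL 0 → ℒ.YL l
  | 0 => fun yv => yv
  | l + 1 => fun yv => ℒ.ry l (ℒ.ryUp l yv)

/-- Composed environment abstraction `rx^{↑l}`. -/
def Layering.rxUp (ℒ : Layering) : (l : ℕ) → ℒ.XL 0 × ℒ.YL 0 → ℒ.XL l
  | 0 => fun p => p.1
  | l + 1 => fun p => ℒ.rx l (ℒ.rxUp l p, ℒ.ryUp l p.2)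

/-- Abstract environment state `x^l(k)` of a (pair of) state sequence(s). -/
def absXF (ℒ : Layering) (x : ℕ → ℒ.XL 0) (y : ℕ → ℒ.YL 0) (l k : ℕ) : ℒ.XL l :=
  if k = 0 then ℒ.rxUp l (x 0, y 0) else ℒ.rxUp l (x k, y (k - 1))

/-- Abstract system state `y^l(k)` of a state sequence. -/
def absYF (ℒ : Layering) (y : ℕ → ℒ.YL 0) (l k : ℕ) : ℒ.YL l := ℒ.ryUp l (y k)

/-- Abstract environment component `x^l(k)` of the abstract play `π^l`. -/
def absX (ℒ : Layering) (π : Play (ℒ.XL 0) (ℒ.YL 0)) (l k : ℕ) : ℒ.XL l :=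
  absXF ℒ π.x π.y l k

/-- Abstract system component `y^l(k)` of the abstract play `π^l`. -/
def absY (ℒ : Layering) (π : Play (ℒ.XL 0) (ℒ.YL 0)) (l k : ℕ) : ℒ.YL l :=
  absYF ℒ π.y l k

/-- `κ` (with domain length `κlen`) is the timescale transformation of the play `π`
at layer `l`: the identity for `l = 0`, and otherwise the strictly increasing
enumeration, starting at `0`, of exactly the time instants at which `y^l` changes. -/
def IsTimescale (ℒ : Layering) (π : Play (ℒ.XL 0) (ℒ.YL 0)) (l : ℕ)
    (κ : ℕ → ℕ) (κlen : ℕ∞) : Prop :=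
  if l = 0 then κlen = π.len ∧ ∀ k, κ k = k
  else
    1 ≤ κlen ∧ κ 0 = 0 ∧
    (∀ m : ℕ, ((m + 1 : ℕ) : ℕ∞) < κlen → κ m < κ (m + 1)) ∧
    (∀ m : ℕ, (m : ℕ∞) < κlen → ((κ m : ℕ) : ℕ∞) < π.len) ∧
    (∀ m : ℕ, ((m + 1 : ℕ) : ℕ∞) < κlen → ∀ k : ℕ, κ m ≤ k → k < κ (m + 1) →
      absY ℒ π l k = absY ℒ π l (κ m) ∧ absY ℒ π l (κ m) ≠ absY ℒ π l (κ (m + 1))) ∧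
    (∀ m : ℕ, κlen = ((m + 1 : ℕ) : ℕ∞) → ∀ k : ℕ, κ m ≤ k → (k : ℕ∞) < π.len →
      absY ℒ π l k = absY ℒ π l (κ m))

/-- The projected play `π̆^l` of `π` at layer `l` w.r.t. the timescale `(κ, κlen)`. -/
def projPlay (ℒ : Layering) (π : Play (ℒ.XL 0) (ℒ.YL 0)) (l : ℕ)
    (κ : ℕ → ℕ) (κlen : ℕ∞) : Play (ℒ.XL l) (ℒ.YL l) :=
  ⟨κlen, fun m => absX ℒ π l (κ m), fun m => absY ℒ π l (κ m)⟩

/-! ## Abstract game graphs -/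

/-- Environment transition map `δe^l` of the abstract game graph at layer `l`. -/
def deL (ℒ : Layering) (G : GameGraph (ℒ.XL 0) (ℒ.YL 0)) :
    (l : ℕ) → ℒ.XL l → ℒ.YL l → Set (ℒ.XL l)
  | 0 => G.de
  | l + 1 => fun xx yy =>
      {x' | ∃ π : Play (ℒ.XL 0) (ℒ.YL 0), IsPlay G π ∧
        ∃ (κ : ℕ → ℕ) (κlen : ℕ∞), IsTimescale ℒ π (l + 1) κ κlen ∧
          (2 : ℕ∞) ≤ κlen ∧
          absX ℒ π (l + 1) (κ 0) = xx ∧ absY ℒ π (l + 1) (κ 0) = yy ∧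
          ∃ k : ℕ, 0 < k ∧ k ≤ κ 1 ∧ absX ℒ π (l + 1) k = x'}

/-- System transition map `δs^l` of the abstract game graph at layer `l`. -/
def dsL (ℒ : Layering) (G : GameGraph (ℒ.XL 0) (ℒ.YL 0)) :
    (l : ℕ) → ℒ.XL l → ℒ.YL l → Set (ℒ.YL l)
  | 0 => G.ds
  | l + 1 => fun xx yy =>
      {y' | ∃ π : Play (ℒ.XL 0) (ℒ.YL 0), IsPlay G π ∧
        ∃ (κ : ℕ → ℕ) (κlen : ℕ∞), IsTimescale ℒ π (l + 1) κ κlen ∧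
          (2 : ℕ∞) ≤ κlen ∧
          absY ℒ π (l + 1) (κ 1 - 1) = yy ∧
          absX ℒ π (l + 1) (κ 1) = xx ∧ absY ℒ π (l + 1) (κ 1) = y'}

/-- The abstract game graph `G^l` at layer `l` (`G^0 = G`). -/
def GLayer (ℒ : Layering) (G : GameGraph (ℒ.XL 0) (ℒ.YL 0)) (l : ℕ) :
    GameGraph (ℒ.XL l) (ℒ.YL l) := ⟨deL ℒ G l, dsL ℒ G l⟩

/-! ## Local game graphs -/

/-- `Post^{l+1}(ν)`. -/
def PostL (ℒ : Layering) (G : GameGraph (ℒ.XL 0) (ℒ.YL 0)) (l : ℕ)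
    (ν : ℒ.YL (l + 1)) : Set (ℒ.YL (l + 1)) :=
  {ν' | ν' ≠ ν ∧ ∃ x : ℒ.XL (l + 1), ν' ∈ dsL ℒ G (l + 1) x ν}

/-- In-states `Yin^l_ν`. -/
def Yin (ℒ : Layering) (l : ℕ) (ν : ℒ.YL (l + 1)) : Set (ℒ.YL l) :=
  {yv | ℒ.ry l yv = ν}

/-- Context-restricted environment states `X^l_ν`. -/
def Xloc (ℒ : Layering) (r : ∀ l : ℕ, ℒ.YL (l + 1) → ℒ.XL l → ℒ.XL l) (l : ℕ)
    (ν : ℒ.YL (l + 1)) : Set (ℒ.XL l) := Set.range (r l ν)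

/-- Out-states `Yout^l_ν`. -/
def Yout (ℒ : Layering) (G : GameGraph (ℒ.XL 0) (ℒ.YL 0))
    (r : ∀ l : ℕ, ℒ.YL (l + 1) → ℒ.XL l → ℒ.XL l) (l : ℕ)
    (ν : ℒ.YL (l + 1)) : Set (ℒ.YL l) :=
  {y' | ∃ ν' ∈ PostL ℒ G l ν, y' ∈ Yin ℒ l ν' ∧
    ∃ yv ∈ Yin ℒ l ν, ∃ xv ∈ Xloc ℒ r l ν, y' ∈ dsL ℒ G l xv yv}

/-- Local system states `Y^l_ν = Yin^l_ν ∪ Yout^l_ν`. -/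
def Yloc (ℒ : Layering) (G : GameGraph (ℒ.XL 0) (ℒ.YL 0))
    (r : ∀ l : ℕ, ℒ.YL (l + 1) → ℒ.XL l → ℒ.XL l) (l : ℕ)
    (ν : ℒ.YL (l + 1)) : Set (ℒ.YL l) := Yin ℒ l ν ∪ Yout ℒ G r l ν

/-- Environment transition map of the local game graph `G^l_ν`. -/
def deLoc (ℒ : Layering) (G : GameGraph (ℒ.XL 0) (ℒ.YL 0))
    (r : ∀ l : ℕ, ℒ.YL (l + 1) → ℒ.XL l → ℒ.XL l) (l : ℕ) (ν : ℒ.YL (l + 1))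
    (xr : ℒ.XL l) (yy : ℒ.YL l) : Set (ℒ.XL l) :=
  {x'' | yy ∈ Yin ℒ l ν ∧ ∃ xv x' : ℒ.XL l,
    xr = r l ν xv ∧ x'' = r l ν x' ∧ x' ∈ deL ℒ G l xv yy}

/-- System transition map of the local game graph `G^l_ν`. -/
def dsLoc (ℒ : Layering) (G : GameGraph (ℒ.XL 0) (ℒ.YL 0))
    (r : ∀ l : ℕ, ℒ.YL (l + 1) → ℒ.XL l → ℒ.XL l) (l : ℕ) (ν : ℒ.YL (l + 1))
    (xr : ℒ.XL l) (yy : ℒ.YL l) : Set (ℒ.YL l) :=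
  {y' | yy ∈ Yin ℒ l ν ∧ y' ∈ Yloc ℒ G r l ν ∧
    ∃ xv : ℒ.XL l, xr = r l ν xv ∧ y' ∈ dsL ℒ G l xv yy}

/-- The local game graph `G^l_ν`. -/
def Gloc (ℒ : Layering) (G : GameGraph (ℒ.XL 0) (ℒ.YL 0))
    (r : ∀ l : ℕ, ℒ.YL (l + 1) → ℒ.XL l → ℒ.XL l) (l : ℕ) (ν : ℒ.YL (l + 1)) :
    GameGraph (ℒ.XL l) (ℒ.YL l) := ⟨deLoc ℒ G r l ν, dsLoc ℒ G r l ν⟩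

/-- Plays of the local game graph `G^l_ν`. -/
def IsLocalPlay (ℒ : Layering) (G : GameGraph (ℒ.XL 0) (ℒ.YL 0))
    (r : ∀ l : ℕ, ℒ.YL (l + 1) → ℒ.XL l → ℒ.XL l) (l : ℕ) (ν : ℒ.YL (l + 1))
    (π : Play (ℒ.XL l) (ℒ.YL l)) : Prop :=
  IsPlay (Gloc ℒ G r l ν) π ∧ π.x 0 ∈ Xloc ℒ r l ν ∧ π.y 0 ∈ Yloc ℒ G r l ν

/-- Assumption 1 ("truly local"). -/
def TrulyLocal (ℒ : Layering) (G : GameGraph (ℒ.XL 0) (ℒ.YL 0))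
    (r : ∀ l : ℕ, ℒ.YL (l + 1) → ℒ.XL l → ℒ.XL l) (L : ℕ) : Prop :=
  ∀ l : ℕ, l < L → ∀ (ν : ℒ.YL (l + 1)) (xv : ℒ.XL l) (yv : ℒ.YL l),
    yv ∈ Yin ℒ l ν → ∀ y' : ℒ.YL l, y' ∈ dsL ℒ G l xv yv → y' ∈ dsL ℒ G l (r l ν xv) yv

/-- Locally restricted environment component `π̆x↓^l(m)` of the projected play. -/
def projXdown (ℒ : Layering) (r : ∀ l : ℕ, ℒ.YL (l + 1) → ℒ.XL l → ℒ.XL l)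
    (π : Play (ℒ.XL 0) (ℒ.YL 0)) (l : ℕ) (κ : ℕ → ℕ) (m : ℕ) : ℒ.XL l :=
  r l (absY ℒ π (l + 1) (κ m - 1)) (absX ℒ π l (κ m))

/-- The segment of the sequences `px, py` starting at position `a` with length `n`. -/
def segPlay {X Y : Type} (px : ℕ → X) (py : ℕ → Y) (a : ℕ) (n : ℕ∞) : Play X Y :=
  ⟨n, fun k => px (a + k), fun k => py (a + k)⟩

/-! ## Local specifications -/

/-- The reachability specification `ψ^l_ν(ν')`. -/
def psiSpec (ℒ : Layering) (G : GameGraph (ℒ.XL 0) (ℒ.YL 0))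
    (r : ∀ l : ℕ, ℒ.YL (l + 1) → ℒ.XL l → ℒ.XL l) (l : ℕ)
    (ν ν' : ℒ.YL (l + 1)) : Set (Play (ℒ.XL l) (ℒ.YL l)) :=
  {π | ν' = ν ∧ IsLocalPlay ℒ G r l ν π ∧ π.len = ⊤ ∧
      ∀ k : ℕ, π.x k ∈ Xloc ℒ r l ν ∧ π.y k ∈ Yin ℒ l ν} ∪
  {π | ν' ≠ ν ∧ IsLocalPlay ℒ G r l ν π ∧ π.Finite ∧
      (∀ k : ℕ, (k : ℕ∞) < π.len → π.x k ∈ Xloc ℒ r l ν ∧ π.y k ∈ Yloc ℒ G r l ν) ∧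
      ∃ n : ℕ, π.len = ((n + 1 : ℕ) : ℕ∞) ∧ π.y n ∈ Yout ℒ G r l ν ∩ Yin ℒ l ν'}

/-- The combined specification `φ ⋄ ψ`: concatenations `ξ·ξ'` with `ξ ∈ φ` and
`last(ξ)·ξ' ∈ ψ`. -/
def concatSpec {X Y : Type} (φ ψ : Set (Play X Y)) : Set (Play X Y) :=
  {π | ∃ n : ℕ, (n : ℕ∞) < π.len ∧ π.prefixPlay n ∈ φ ∧ π.suffixPlay n ∈ ψ}

/-! ## Hierarchical reactive games and Algorithm 1 -/

/-- The data of a hierarchical reactive game `([G], I, [φ])` with local environment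
assumptions `[ζ]`, over a set of local game graphs satisfying Assumption 1, together
with the solver `Sol` used by Algorithm 1. -/
structure HRGSetting where
  ℒ : Layering
  L : ℕ
  Lpos : 0 < L
  G : GameGraph (ℒ.XL 0) (ℒ.YL 0)
  serial : G.Serial
  r : ∀ l : ℕ, ℒ.YL (l + 1) → ℒ.XL l → ℒ.XL l
  rL_id : ∀ (ν : ℒ.YL (L + 1)) (xx : ℒ.XL L), r L ν xx = xx
  trulyLocal : TrulyLocal ℒ G r L
  φloc : ∀ l : ℕ, ℒ.YL (l + 1) → Set (Play (ℒ.XL l) (ℒ.YL l))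
  ζloc : ∀ l : ℕ, ℒ.YL (l + 1) → Set (Play (ℒ.XL l) (ℒ.YL l))
  φL : Set (Play (ℒ.XL L) (ℒ.YL L))
  ζL : Set (Play (ℒ.XL L) (ℒ.YL L))
  I0 : ℒ.XL 0 × ℒ.YL 0
  φloc_spec : ∀ l : ℕ, l < L → ∀ (ν : ℒ.YL (l + 1)) π, π ∈ φloc l ν →
    π.Finite ∧ IsLocalPlay ℒ G r l ν π ∧
      ∀ k : ℕ, (k : ℕ∞) < π.len → π.x k ∈ Xloc ℒ r l ν ∧ π.y k ∈ Yin ℒ l ν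
  ζloc_spec : ∀ l : ℕ, l < L → ∀ (ν : ℒ.YL (l + 1)) π, π ∈ ζloc l ν →
    IsLocalPlay ℒ G r l ν π ∧
      ∀ k : ℕ, (k : ℕ∞) < π.len → π.x k ∈ Xloc ℒ r l ν ∧ π.y k ∈ Yin ℒ l ν
  φL_spec : ∀ π ∈ φL, IsPlay (GLayer ℒ G L) π
  ζL_spec : ∀ π ∈ ζL, IsPlay (GLayer ℒ G L) π
  Sol : ∀ l : ℕ, GameGraph (ℒ.XL l) (ℒ.YL l) → Set (List (ℒ.XL l × ℒ.YL l)) →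
    Set (Play (ℒ.XL l) (ℒ.YL l)) → Set (Play (ℒ.XL l) (ℒ.YL l)) →
    SysStrategy (ℒ.XL l) (ℒ.YL l)
  SolStrat : ∀ l G' I' φ' ζ', IsSysStrategy G' (Sol l G' I' φ' ζ')
  SolSpec : ∀ l G' I' φ' ζ', IsSol G' I' φ' ζ' (Sol l G' I' φ' ζ')

namespace HRGSetting

/-- The sensed, locally restricted abstract environment state `x̆^l(k+1)`. -/
def xSen (S : HRGSetting) (x : ℕ → S.ℒ.XL 0) (y : ℕ → S.ℒ.YL 0) (l k : ℕ) :
    S.ℒ.XL l :=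
  S.r l (S.ℒ.ryUp (l + 1) (y k)) (absXF S.ℒ x y l (k + 1))

/-- A string at layer `l` interpreted as a play (using default states). -/
def toPlayL (S : HRGSetting) (l : ℕ) (w : List (S.ℒ.XL l × S.ℒ.YL l)) :
    Play (S.ℒ.XL l) (S.ℒ.YL l) :=
  listToPlay (S.ℒ.defX l) (S.ℒ.defY l) w

/-- The initial string `I^l(0)` at layer `l`. -/
def initStr (S : HRGSetting) (l : ℕ) : List (S.ℒ.XL l × S.ℒ.YL l) :=
  [(S.ℒ.rxUp l S.I0, S.ℒ.ryUp l S.I0.2)]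

/-- The predicate `Win^l(k)`. -/
def WinP (S : HRGSetting) (y : ℕ → S.ℒ.YL 0)
    (γ : ∀ l : ℕ, ℕ → List (S.ℒ.XL l × S.ℒ.YL l)) (l k : ℕ) : Prop :=
  (l = S.L ∧ S.toPlayL S.L (γ S.L k) ∈ S.φL) ∨
  (l ≠ S.L ∧ S.toPlayL l (γ l k) ∈ S.φloc l (S.ℒ.ryUp (l + 1) (y k)))

/-- The predicate `GotStuck^l(k)`. -/
def GotStuckP (S : HRGSetting) (x : ℕ → S.ℒ.XL 0) (y : ℕ → S.ℒ.YL 0)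
    (γ : ∀ l : ℕ, ℕ → List (S.ℒ.XL l × S.ℒ.YL l))
    (f : ∀ l : ℕ, ℕ → SysStrategy (S.ℒ.XL l) (S.ℒ.YL l))
    (Done : ℕ → ℕ → Prop) (l k : ℕ) : Prop :=
  ¬ Done l k ∧ f l k (γ l k) (S.xSen x y l k) = none

/-- The predicate `UnReal^l(k)`. -/
def UnRealP (S : HRGSetting) (x : ℕ → S.ℒ.XL 0) (y : ℕ → S.ℒ.YL 0)
    (γ : ∀ l : ℕ, ℕ → List (S.ℒ.XL l × S.ℒ.YL l))
    (f : ∀ l : ℕ, ℕ → SysStrategy (S.ℒ.XL l) (S.ℒ.YL l))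
    (Done : ℕ → ℕ → Prop) (l k : ℕ) : Prop :=
  (l = S.L ∧ S.GotStuckP x y γ f Done l k) ∨
  (l ≠ S.L ∧ ¬ S.GotStuckP x y γ f Done (l + 1) k ∧ S.GotStuckP x y γ f Done l k)

/-- The move `ν'(k)` requested by the layer-`(l+1)` strategy. -/
def nuP (S : HRGSetting) (x : ℕ → S.ℒ.XL 0) (y : ℕ → S.ℒ.YL 0)
    (γ : ∀ l : ℕ, ℕ → List (S.ℒ.XL l × S.ℒ.YL l))
    (f : ∀ l : ℕ, ℕ → SysStrategy (S.ℒ.XL l) (S.ℒ.YL l))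
    (l k : ℕ) : Option (S.ℒ.YL (l + 1)) :=
  f (l + 1) k (γ (l + 1) k) (S.xSen x y (l + 1) k)

end HRGSetting

/-- An execution trace of Algorithm 1 (the dynamic hierarchical strategy synthesis):
the computed play `(x, y)` of length `len`, the local histories `γ^l(k)`, the
strategies `f^l(k)`, `h^l(k)`, `f^l_{νν'}(k)` and the predicate `Done^l(k)`,
subject to the defining equations of the algorithm. -/
structure AlgRun (S : HRGSetting) where
  len : ℕ∞
  x : ℕ → S.ℒ.XL 0
  y : ℕ → S.ℒ.YL 0
  γ : ∀ l : ℕ, ℕ → List (S.ℒ.XL l × S.ℒ.YL l)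
  f : ∀ l : ℕ, ℕ → SysStrategy (S.ℒ.XL l) (S.ℒ.YL l)
  h : ∀ l : ℕ, ℕ → SysStrategy (S.ℒ.XL l) (S.ℒ.YL l)
  fR : ∀ l : ℕ, ℕ → SysStrategy (S.ℒ.XL l) (S.ℒ.YL l)
  Done : ℕ → ℕ → Prop
  lenPos : 1 ≤ len
  initx : x 0 = S.I0.1
  inity : y 0 = S.I0.2
  γ_init : ∀ l : ℕ, γ l 0 = [(S.ℒ.rxUp l (x 0, y 0), S.ℒ.ryUp l (y 0))]
  sense : ∀ k : ℕ, (k : ℕ∞) < len → x (k + 1) ∈ S.G.de (x k) (y k)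
  hL_def : ∀ k : ℕ, (k : ℕ∞) < len →
    h S.L k = S.Sol S.L (GLayer S.ℒ S.G S.L) {S.initStr S.L} S.φL S.ζL
  fL_def : ∀ k : ℕ, (k : ℕ∞) < len → f S.L k = h S.L k
  done_iff : ∀ l k : ℕ, l ≤ S.L → (k : ℕ∞) < len →
    (Done l k ↔ ((l = S.L ∨ Done (l + 1) k) ∧ S.WinP y γ l k ∧
      h l k (γ l k) (S.xSen x y l k) = none))
  f_stuck : ∀ l : ℕ, l < S.L → ∀ k : ℕ, (k : ℕ∞) < len →
    S.GotStuckP x y γ f Done (l + 1) k → f l k = fun _ _ => none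
  f_done : ∀ l : ℕ, l < S.L → ∀ k : ℕ, (k : ℕ∞) < len →
    ¬ S.GotStuckP x y γ f Done (l + 1) k → Done (l + 1) k → f l k = h l k
  f_reach : ∀ l : ℕ, l < S.L → ∀ k : ℕ, (k : ℕ∞) < len →
    ¬ S.GotStuckP x y γ f Done (l + 1) k → ¬ Done (l + 1) k → f l k = fR l k
  h_fresh0 : ∀ l : ℕ, l < S.L →
    h l 0 = S.Sol l (Gloc S.ℒ S.G S.r l (S.ℒ.ryUp (l + 1) (y 0))) {γ l 0}
      (S.φloc l (S.ℒ.ryUp (l + 1) (y 0))) (S.ζloc l (S.ℒ.ryUp (l + 1) (y 0)))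
  h_fresh : ∀ l : ℕ, l < S.L → ∀ k : ℕ, ((k + 1 : ℕ) : ℕ∞) < len →
    S.ℒ.ryUp (l + 1) (y (k + 1)) ≠ S.ℒ.ryUp (l + 1) (y k) →
    h l (k + 1) = S.Sol l (Gloc S.ℒ S.G S.r l (S.ℒ.ryUp (l + 1) (y (k + 1))))
      {γ l (k + 1)} (S.φloc l (S.ℒ.ryUp (l + 1) (y (k + 1))))
      (S.ζloc l (S.ℒ.ryUp (l + 1) (y (k + 1))))
  h_keep : ∀ l : ℕ, l < S.L → ∀ k : ℕ, ((k + 1 : ℕ) : ℕ∞) < len →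
    S.ℒ.ryUp (l + 1) (y (k + 1)) = S.ℒ.ryUp (l + 1) (y k) → h l (k + 1) = h l k
  fR_fresh0 : ∀ l : ℕ, l < S.L → ∀ ν' : S.ℒ.YL (l + 1),
    S.nuP x y γ f l 0 = some ν' →
    fR l 0 = S.Sol l (Gloc S.ℒ S.G S.r l (S.ℒ.ryUp (l + 1) (y 0))) {γ l 0}
      (concatSpec (S.φloc l (S.ℒ.ryUp (l + 1) (y 0)))
        (psiSpec S.ℒ S.G S.r l (S.ℒ.ryUp (l + 1) (y 0)) ν'))
      (S.ζloc l (S.ℒ.ryUp (l + 1) (y 0)))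
  fR_fresh : ∀ l : ℕ, l < S.L → ∀ k : ℕ, ((k + 1 : ℕ) : ℕ∞) < len →
    ∀ ν' : S.ℒ.YL (l + 1), S.nuP x y γ f l (k + 1) = some ν' →
    (S.ℒ.ryUp (l + 1) (y (k + 1)) ≠ S.ℒ.ryUp (l + 1) (y k) ∨
      S.nuP x y γ f l (k + 1) ≠ S.nuP x y γ f l k) →
    fR l (k + 1) = S.Sol l (Gloc S.ℒ S.G S.r l (S.ℒ.ryUp (l + 1) (y (k + 1))))
      {γ l (k + 1)}
      (concatSpec (S.φloc l (S.ℒ.ryUp (l + 1) (y (k + 1))))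
        (psiSpec S.ℒ S.G S.r l (S.ℒ.ryUp (l + 1) (y (k + 1))) ν'))
      (S.ζloc l (S.ℒ.ryUp (l + 1) (y (k + 1))))
  fR_keep : ∀ l : ℕ, l < S.L → ∀ k : ℕ, ((k + 1 : ℕ) : ℕ∞) < len →
    S.ℒ.ryUp (l + 1) (y (k + 1)) = S.ℒ.ryUp (l + 1) (y k) →
    S.nuP x y γ f l (k + 1) = S.nuP x y γ f l k → fR l (k + 1) = fR l k
  step : ∀ k : ℕ, ((k + 1 : ℕ) : ℕ∞) < len →
    f 0 k (γ 0 k) (S.xSen x y 0 k) = some (y (k + 1))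
  γ_reset : ∀ l : ℕ, l < S.L → ∀ k : ℕ, ((k + 1 : ℕ) : ℕ∞) < len →
    S.ℒ.ryUp (l + 1) (y (k + 1)) ≠ S.ℒ.ryUp (l + 1) (y k) →
    γ l (k + 1) = [(S.xSen x y l k, S.ℒ.ryUp l (y (k + 1)))]
  γ_app : ∀ l : ℕ, l < S.L → ∀ k : ℕ, ((k + 1 : ℕ) : ℕ∞) < len →
    S.ℒ.ryUp (l + 1) (y (k + 1)) = S.ℒ.ryUp (l + 1) (y k) →
    (l = 0 ∨ S.ℒ.ryUp l (y (k + 1)) ≠ S.ℒ.ryUp l (y k)) →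
    γ l (k + 1) = γ l k ++ [(S.xSen x y l k, S.ℒ.ryUp l (y (k + 1)))]
  γ_keep : ∀ l : ℕ, l < S.L → ∀ k : ℕ, ((k + 1 : ℕ) : ℕ∞) < len →
    S.ℒ.ryUp (l + 1) (y (k + 1)) = S.ℒ.ryUp (l + 1) (y k) →
    l ≠ 0 → S.ℒ.ryUp l (y (k + 1)) = S.ℒ.ryUp l (y k) → γ l (k + 1) = γ l k
  γ_appL : ∀ k : ℕ, ((k + 1 : ℕ) : ℕ∞) < len →
    S.ℒ.ryUp S.L (y (k + 1)) ≠ S.ℒ.ryUp S.L (y k) →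
    γ S.L (k + 1) = γ S.L k ++ [(S.xSen x y S.L k, S.ℒ.ryUp S.L (y (k + 1)))]
  γ_keepL : ∀ k : ℕ, ((k + 1 : ℕ) : ℕ∞) < len →
    S.ℒ.ryUp S.L (y (k + 1)) = S.ℒ.ryUp S.L (y k) → γ S.L (k + 1) = γ S.L k

namespace AlgRun

variable {S : HRGSetting}

/-- The play computed by the algorithm. -/
def play (R : AlgRun S) : Play (S.ℒ.XL 0) (S.ℒ.YL 0) := ⟨R.len, R.x, R.y⟩

/-- The computed play is maximal: if it is finite, the layer-0 strategy is undefined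
at the final configuration. -/
def Maximal (R : AlgRun S) : Prop :=
  ∀ n : ℕ, R.len = ((n + 1 : ℕ) : ℕ∞) →
    R.f 0 n (R.γ 0 n) (S.xSen R.x R.y 0 n) = none

end AlgRun

/-! ## Local projected play sequences and winning conditions for HRGs -/

/-- `seg` is the `m`-th local projected play `p̆^l(m)` of `π`, w.r.t. timescales
`(κl, κlenl)` at layer `l` and `(κl1, κlenl1)` at layer `l+1`. -/
def LocalSeg (ℒ : Layering) (r : ∀ l : ℕ, ℒ.YL (l + 1) → ℒ.XL l → ℒ.XL l)
    (π : Play (ℒ.XL 0) (ℒ.YL 0)) (l : ℕ)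
    (κl : ℕ → ℕ) (κlenl : ℕ∞) (κl1 : ℕ → ℕ) (κlenl1 : ℕ∞) (m : ℕ)
    (seg : Play (ℒ.XL l) (ℒ.YL l)) : Prop :=
  ∃ m' : ℕ, (m' : ℕ∞) < κlenl ∧ κl m' = κl1 m ∧
    ((∃ m'' : ℕ, (m'' : ℕ∞) < κlenl ∧ ((m + 1 : ℕ) : ℕ∞) < κlenl1 ∧
        κl m'' = κl1 (m + 1) ∧
        seg = segPlay (projXdown ℒ r π l κl) (fun j => absY ℒ π l (κl j)) m'
          ((m'' - m' + 1 : ℕ) : ℕ∞)) ∨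
     (κlenl1 = ((m + 1 : ℕ) : ℕ∞) ∧
        seg = segPlay (projXdown ℒ r π l κl) (fun j => absY ℒ π l (κl j)) m'
          (κlenl - (m' : ℕ∞))))

/-- The local initial condition `I^l(m)`: the initial string for `m = 0`, and the
one-element string consisting of the last state of `p̆^l(m-1)` otherwise (this state sits
at position `m'`, the layer-`l` position of the `m`-th layer-`(l+1)` event). -/
def segInit (ℒ : Layering) (r : ∀ l : ℕ, ℒ.YL (l + 1) → ℒ.XL l → ℒ.XL l)
    (π : Play (ℒ.XL 0) (ℒ.YL 0)) (l : ℕ) (κl : ℕ → ℕ) (m m' : ℕ)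
    (i0 : ℒ.XL 0 × ℒ.YL 0) : Set (List (ℒ.XL l × ℒ.YL l)) :=
  if m = 0 then {[(ℒ.rxUp l i0, ℒ.ryUp l i0.2)]}
  else {[(projXdown ℒ r π l κl m', absY ℒ π l (κl m'))]}

/-- The set of local projected play sequences of `π` is possibly winning for the
hierarchical reactive game. -/
def PossiblyWinningHRG (S : HRGSetting) (π : Play (S.ℒ.XL 0) (S.ℒ.YL 0)) : Prop :=
  (∀ l : ℕ, l < S.L → ∀ (κl κl1 : ℕ → ℕ) (κlenl κlenl1 : ℕ∞),
    IsTimescale S.ℒ π l κl κlenl → IsTimescale S.ℒ π (l + 1) κl1 κlenl1 →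
    ∀ m m' : ℕ, (m : ℕ∞) < κlenl1 → (m' : ℕ∞) < κlenl → κl m' = κl1 m →
    ∀ seg, LocalSeg S.ℒ S.r π l κl κlenl κl1 κlenl1 m seg →
      ((((m + 1 : ℕ) : ℕ∞) < κlenl1 →
        ∃ ξ : Play (S.ℒ.XL l) (S.ℒ.YL l), ξ.Prefix seg ∧
          WinningPlay (segInit S.ℒ S.r π l κl m m' S.I0)
            (S.φloc l (absY S.ℒ π (l + 1) (κl1 m))) ξ) ∧
       (κlenl1 = ((m + 1 : ℕ) : ℕ∞) →
        ∃ ξ : Play (S.ℒ.XL l) (S.ℒ.YL l), (ξ.Prefix seg ∨ seg.Prefix ξ) ∧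
          WinningPlay (segInit S.ℒ S.r π l κl m m' S.I0)
            (S.φloc l (absY S.ℒ π (l + 1) (κl1 m))) ξ))) ∧
  (∀ (κL : ℕ → ℕ) (κlenL : ℕ∞), IsTimescale S.ℒ π S.L κL κlenL →
    PossiblyWinningPlay {S.initStr S.L} S.φL (projPlay S.ℒ π S.L κL κlenL))

/-- The set of local projected play sequences of `π` is winning for the hierarchical
reactive game. -/
def WinningHRG (S : HRGSetting) (π : Play (S.ℒ.XL 0) (S.ℒ.YL 0)) : Prop :=
  (∀ l : ℕ, l < S.L → ∀ (κl κl1 : ℕ → ℕ) (κlenl κlenl1 : ℕ∞),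
    IsTimescale S.ℒ π l κl κlenl → IsTimescale S.ℒ π (l + 1) κl1 κlenl1 →
    ∀ m m' : ℕ, (m : ℕ∞) < κlenl1 → (m' : ℕ∞) < κlenl → κl m' = κl1 m →
    ∀ seg, LocalSeg S.ℒ S.r π l κl κlenl κl1 κlenl1 m seg →
      ((((m + 1 : ℕ) : ℕ∞) < κlenl1 →
        ∃ ξ : Play (S.ℒ.XL l) (S.ℒ.YL l), ξ.Prefix seg ∧
          WinningPlay (segInit S.ℒ S.r π l κl m m' S.I0)
            (S.φloc l (absY S.ℒ π (l + 1) (κl1 m))) ξ) ∧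
       (κlenl1 = ((m + 1 : ℕ) : ℕ∞) →
        WinningPlay (segInit S.ℒ S.r π l κl m m' S.I0)
          (S.φloc l (absY S.ℒ π (l + 1) (κl1 m))) seg))) ∧
  (∀ (κL : ℕ → ℕ) (κlenL : ℕ∞), IsTimescale S.ℒ π S.L κL κlenL →
    WinningPlay {S.initStr S.L} S.φL (projPlay S.ℒ π S.L κL κlenL))

/-- `π` is an environment admissible play: every local projected play is compliant with
some admissible environment strategy of the corresponding local game, and the projected
play at layer `L` is compliant with some admissible environment strategy of `G^L`. -/
def EnvAdmPlay (S : HRGSetting) (π : Play (S.ℒ.XL 0) (S.ℒ.YL 0)) : Prop :=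
  (∀ l : ℕ, l < S.L → ∀ (κl κl1 : ℕ → ℕ) (κlenl κlenl1 : ℕ∞),
    IsTimescale S.ℒ π l κl κlenl → IsTimescale S.ℒ π (l + 1) κl1 κlenl1 →
    ∀ m m' : ℕ, (m : ℕ∞) < κlenl1 → (m' : ℕ∞) < κlenl → κl m' = κl1 m →
    ∀ seg, LocalSeg S.ℒ S.r π l κl κlenl κl1 κlenl1 m seg →
      ∃ g : EnvStrategy (S.ℒ.XL l) (S.ℒ.YL l),
        EnvAdmissible (Gloc S.ℒ S.G S.r l (absY S.ℒ π (l + 1) (κl1 m)))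
          (segInit S.ℒ S.r π l κl m m' S.I0)
          (S.ζloc l (absY S.ℒ π (l + 1) (κl1 m))) g ∧
        CompliantWithEnv g (segInit S.ℒ S.r π l κl m m' S.I0) seg) ∧
  (∀ (κL : ℕ → ℕ) (κlenL : ℕ∞), IsTimescale S.ℒ π S.L κL κlenL →
    ∃ g : EnvStrategy (S.ℒ.XL S.L) (S.ℒ.YL S.L),
      EnvAdmissible (GLayer S.ℒ S.G S.L) {S.initStr S.L} S.ζL g ∧
      CompliantWithEnv g {S.initStr S.L} (projPlay S.ℒ π S.L κL κlenL))

end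

/-- The layer-`(l + 1)` state is determined by the layer-`l` state. -/
theorem absY_succ_congr {ℒ : Layering} {π : Play (ℒ.XL 0) (ℒ.YL 0)} {l a b : ℕ}
    (h : absY ℒ π l a = absY ℒ π l b) : absY ℒ π (l + 1) a = absY ℒ π (l + 1) b :=
  congrArg (ℒ.ry l) h

namespace IsTimescale

variable {ℒ : Layering} {π : Play (ℒ.XL 0) (ℒ.YL 0)} {l : ℕ} {κ : ℕ → ℕ} {κlen : ℕ∞}

theorem one_le_len (hπ : 1 ≤ π.len) (h : IsTimescale ℒ π l κ κlen) : 1 ≤ κlen := by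
  unfold IsTimescale at h
  split_ifs at h
  · exact h.1 ▸ hπ
  · exact h.1

theorem apply_zero (h : IsTimescale ℒ π l κ κlen) : κ 0 = 0 := by
  unfold IsTimescale at h
  split_ifs at h
  · exact h.2 0
  · exact h.2.1

theorem lt_succ (h : IsTimescale ℒ π l κ κlen) {m : ℕ} (hm : ((m + 1 : ℕ) : ℕ∞) < κlen) :
    κ m < κ (m + 1) := by
  unfold IsTimescale at h
  split_ifs at h
  · simp [h.2]
  · exact h.2.2.1 m hm

theorem lt_len (h : IsTimescale ℒ π l κ κlen) {m : ℕ} (hm : (m : ℕ∞) < κlen) :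
    (κ m : ℕ∞) < π.len := by
  unfold IsTimescale at h
  split_ifs at h
  · rw [h.2, ← h.1]
    exact hm
  · exact h.2.2.2.1 m hm

theorem apply_le_apply (h : IsTimescale ℒ π l κ κlen) {a b : ℕ} (hab : a ≤ b)
    (hb : (b : ℕ∞) < κlen) : κ a ≤ κ b := by
  induction b, hab using Nat.le_induction with
  | base => exact le_rfl
  | succ n _ ih =>
    exact (ih (lt_trans (by exact_mod_cast n.lt_succ_self) hb)).trans (h.lt_succ hb).le

theorem le_apply (h : IsTimescale ℒ π l κ κlen) (m : ℕ) (hm : (m : ℕ∞) < κlen) : m ≤ κ m := by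
  induction m with
  | zero => exact Nat.zero_le _
  | succ n ih =>
    exact (ih (lt_trans (by exact_mod_cast n.lt_succ_self) hm)).trans_lt (h.lt_succ hm)

/-- At a positive entry of the timescale of a positive layer, the abstract state changes. -/
theorem absY_pred_ne (h : IsTimescale ℒ π (l + 1) κ κlen) {m : ℕ}
    (hm : ((m + 1 : ℕ) : ℕ∞) < κlen) :
    absY ℒ π (l + 1) (κ (m + 1) - 1) ≠ absY ℒ π (l + 1) (κ (m + 1)) := by
  have hlt := h.lt_succ hm
  rw [IsTimescale, if_neg l.succ_ne_zero] at h
  obtain ⟨heq, hne⟩ := h.2.2.2.2.1 m hm (κ (m + 1) - 1) (by omega) (by omega)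
  rwa [heq]

/-- Every instant at which the abstract state changes is an entry of the timescale. -/
theorem exists_apply_eq (hπ : 1 ≤ π.len) (h : IsTimescale ℒ π l κ κlen) {t : ℕ} (ht : 0 < t)
    (htlen : (t : ℕ∞) < π.len) (hne : absY ℒ π l (t - 1) ≠ absY ℒ π l t) :
    ∃ m : ℕ, (m : ℕ∞) < κlen ∧ κ m = t := by
  have hlen := h.one_le_len hπ
  by_contra! hmiss
  have h' := h
  unfold IsTimescale at h'
  split_ifs at h' with hl
  · exact hmiss t (h'.1 ▸ htlen) (h'.2 t)
  obtain ⟨-, -, -, -, hconst, hlast⟩ := h'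
  have hbelow : ∀ m : ℕ, (m : ℕ∞) < κlen → κ m < t := by
    intro m
    induction m with
    | zero => exact fun _ => h.apply_zero.trans_lt ht
    | succ n ih =>
      intro hn
      have hκ := ih (lt_trans (by exact_mod_cast n.lt_succ_self) hn)
      by_contra! hle
      have hlt := lt_of_le_of_ne hle (hmiss _ hn).symm
      exact hne ((hconst n hn (t - 1) (by omega) (by omega)).1.trans
        (hconst n hn t hκ.le hlt).1.symm)
  induction κlen using ENat.recTopCoe with
  | top => exact absurd (hbelow t (ENat.natCast_lt_top t)) (h.le_apply t (ENat.natCast_lt_top t)).not_gt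
  | coe N =>
    obtain ⟨n, rfl⟩ : ∃ n, N = n + 1 := Nat.exists_eq_add_of_le' (by exact_mod_cast hlen)
    have hκ := hbelow n (by exact_mod_cast n.lt_succ_self)
    exact hne ((hlast n rfl (t - 1) (by omega)
      (lt_of_le_of_lt (by exact_mod_cast t.sub_le 1) htlen)).trans
        (hlast n rfl t hκ.le htlen).symm)

end IsTimescale

/-- for every play of a serial game graph with a layering of depth `L` and
every layer `l ∈ [0, L-1]`, every entry of the timescale transformation `κ^{l+1}` occurs
among the entries of `κ^l`; moreover the last entry of `κ^l` is at least the last entry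
of `κ^{l+1}`. -/
theorem timescale_nested (ℒ : Layering) (G : GameGraph (ℒ.XL 0) (ℒ.YL 0))
    (hG : G.Serial) (L : ℕ) (π : Play (ℒ.XL 0) (ℒ.YL 0)) (hπ : IsPlay G π)
    (l : ℕ) (hl : l + 1 ≤ L)
    (κl κl1 : ℕ → ℕ) (κlenl κlenl1 : ℕ∞)
    (h1 : IsTimescale ℒ π l κl κlenl) (h2 : IsTimescale ℒ π (l + 1) κl1 κlenl1) :
    (∀ k : ℕ, (k : ℕ∞) < κlenl1 → ∃ m : ℕ, (m : ℕ∞) < κlenl ∧ κl1 k = κl m) ∧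
    (∀ mlast m1last : ℕ, κlenl = ((mlast + 1 : ℕ) : ℕ∞) →
      κlenl1 = ((m1last + 1 : ℕ) : ℕ∞) → κl1 m1last ≤ κl mlast) := by
  have hnested : ∀ k : ℕ, (k : ℕ∞) < κlenl1 → ∃ m : ℕ, (m : ℕ∞) < κlenl ∧ κl1 k = κl m := by
    intro k hk
    cases k with
    | zero =>
      exact ⟨0, lt_of_lt_of_le (by simp) (h1.one_le_len hπ.1), by rw [h1.apply_zero, h2.apply_zero]⟩
    | succ n =>
      obtain ⟨m, hm, heq⟩ := h1.exists_apply_eq hπ.1 (Nat.zero_lt_of_lt (h2.lt_succ hk))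
        (h2.lt_len hk) (mt absY_succ_congr (h2.absY_pred_ne hk))
      exact ⟨m, hm, heq.symm⟩
  refine ⟨hnested, ?_⟩
  rintro mlast m1last rfl rfl
  obtain ⟨m, hm, heq⟩ := hnested m1last (by exact_mod_cast m1last.lt_succ_self)
  rw [heq]
  exact h1.apply_le_apply (Nat.lt_succ_iff.mp (by exact_mod_cast hm))
    (by exact_mod_cast mlast.lt_succ_self)
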